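/- arXiv:2509.05737 — 5 statements merged into one kernel-verified Lean document; each statement's English description precedes it below -/
import Mathlib

section
/- Let ρ_0 : (Fin m → ℝ) → ℝ be monotone, let X : Fin m → Ω → ℝ be a random vector, and write R(X) = (fun i => ρ_i (X i)). Suppose ν : Fin m → ℝ is a subgradient of ρ_0 at R(X) with respect to ⟨·,·⟩_c, and for each i : Fin m, ξ_i : Ω → ℝ is a subgradient of ρ_i at X i with respect to ⟨·,·⟩_p. Then the pair (ν, ξ) yields a subgradient of ρ_sys at X: for every random vector Y : Fin m → Ω → ℝ, ρ_sys(Y) ≥ ρ_sys(X) + ∑_i c i · ν i · (∑_ω p ω · ξ_i ω · (Y i ω − X i ω)). -/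
/-- Chain rule for subgradients of the systemic risk measure: if `ρ₀` is
monotone, `ν` is a subgradient of `ρ₀` at `R(X) = fun i => ρ i (X i)` w.r.t. the pairing
`⟨ν, v⟩_c = ∑ i, c i * ν i * v i`, and each `ξ i` is a subgradient of `ρ i` at `X i`
w.r.t. the pairing `⟨ξ, Z⟩_p = ∑ ω, p ω * ξ ω * Z ω`, then `(ν, ξ)` yields a subgradient
of `ρ_sys` at `X`. -/
theorem systemic_risk_subgradient {Ω : Type*} [Fintype Ω] [Nonempty Ω] {m : ℕ} (hm : 1 ≤ m)
    (p : Ω → ℝ) (hp : ∀ ω, 0 < p ω) (hp1 : ∑ ω, p ω = 1)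
    (c : Fin m → ℝ) (hc : ∀ i, 0 < c i) (hc1 : ∑ i, c i = 1)
    (ρ : Fin m → (Ω → ℝ) → ℝ) (ρ₀ : (Fin m → ℝ) → ℝ)
    (hρ₀mono : ∀ u v : Fin m → ℝ, (∀ i, u i ≤ v i) → ρ₀ u ≤ ρ₀ v)
    (X : Fin m → Ω → ℝ) (ν : Fin m → ℝ) (ξ : Fin m → Ω → ℝ)
    (hν : ∀ v : Fin m → ℝ,
      ρ₀ v ≥ ρ₀ (fun i => ρ i (X i)) + ∑ i, c i * ν i * (v i - ρ i (X i)))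
    (hξ : ∀ i : Fin m, ∀ Z : Ω → ℝ,
      ρ i Z ≥ ρ i (X i) + ∑ ω, p ω * ξ i ω * (Z ω - X i ω)) :
    ∀ Y : Fin m → Ω → ℝ,
      ρ₀ (fun i => ρ i (Y i)) ≥ ρ₀ (fun i => ρ i (X i)) +
        ∑ i, c i * ν i * (∑ ω, p ω * ξ i ω * (Y i ω - X i ω)) := by
  intro Y
  have hsub := hν (fun i => ρ i (X i) + ∑ ω, p ω * ξ i ω * (Y i ω - X i ω))
  simp only [add_sub_cancel_left] at hsub
  exact hsub.le.trans (hρ₀mono _ _ fun i => hξ i (Y i))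
end

section
/- Suppose each ρ_i (i : Fin m) and ρ_0 are positively homogeneous, let X : Fin m → Ω → ℝ be a random vector and write R(X) = (fun i => ρ_i (X i)). If ν : Fin m → ℝ is a subgradient of ρ_0 at R(X) with respect to ⟨·,·⟩_c and, for each i, ξ_i : Ω → ℝ is a subgradient of ρ_i at X i with respect to ⟨·,·⟩_p, then ∑_i c i · ν i · (∑_ω p ω · ξ_i ω · X i ω) = ρ_sys(X). -/
/-- Euler's identity for subgradients: a positively homogeneous functional agrees at `x` with
the pairing of `x` with any of its subgradients at `x`. -/
theorem eq_weighted_sum_of_posHomogeneous_of_subgradient {ι : Type*} [Fintype ι]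
    (f : (ι → ℝ) → ℝ) (hf : ∀ v : ι → ℝ, ∀ t : ℝ, 0 < t → f (t • v) = t * f v)
    (w x : ι → ℝ) (hw : ∀ y : ι → ℝ, f y ≥ f x + ∑ i, w i * (y i - x i)) :
    f x = ∑ i, w i * x i := by
  have key : ∀ t : ℝ, 0 < t → t * f x ≥ f x + (t - 1) * ∑ i, w i * x i := by
    intro t ht
    have h := hw (t • x)
    rw [hf x t ht] at h
    have hsum : ∑ i, w i * ((t • x) i - x i) = (t - 1) * ∑ i, w i * x i := by
      rw [Finset.mul_sum]
      refine Finset.sum_congr rfl fun i _ => ?_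
      simp only [Pi.smul_apply, smul_eq_mul]
      ring
    rwa [hsum] at h
  have h₁ := key 2 (by norm_num)
  have h₂ := key (1 / 2) (by norm_num)
  linarith


/-- If each `ρ i` and `ρ₀` are positively homogeneous, `ν` is a subgradient
of `ρ₀` at `R(X)` w.r.t. `⟨·,·⟩_c` and each `ξ i` is a subgradient of `ρ i` at `X i`
w.r.t. `⟨·,·⟩_p`, then the combined pairing of `(ν, ξ)` with `X` equals `ρ_sys X`. -/
theorem systemic_risk_subgradient_pairing {Ω : Type*} [Fintype Ω] [Nonempty Ω] {m : ℕ}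
    (hm : 1 ≤ m)
    (p : Ω → ℝ) (hp : ∀ ω, 0 < p ω) (hp1 : ∑ ω, p ω = 1)
    (c : Fin m → ℝ) (hc : ∀ i, 0 < c i) (hc1 : ∑ i, c i = 1)
    (ρ : Fin m → (Ω → ℝ) → ℝ) (ρ₀ : (Fin m → ℝ) → ℝ)
    (hρph : ∀ i : Fin m, ∀ Z : Ω → ℝ, ∀ t : ℝ, 0 < t → ρ i (t • Z) = t * ρ i Z)
    (hρ₀ph : ∀ v : Fin m → ℝ, ∀ t : ℝ, 0 < t → ρ₀ (t • v) = t * ρ₀ v)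
    (X : Fin m → Ω → ℝ) (ν : Fin m → ℝ) (ξ : Fin m → Ω → ℝ)
    (hν : ∀ v : Fin m → ℝ,
      ρ₀ v ≥ ρ₀ (fun i => ρ i (X i)) + ∑ i, c i * ν i * (v i - ρ i (X i)))
    (hξ : ∀ i : Fin m, ∀ Z : Ω → ℝ,
      ρ i Z ≥ ρ i (X i) + ∑ ω, p ω * ξ i ω * (Z ω - X i ω)) :
    ∑ i, c i * ν i * (∑ ω, p ω * ξ i ω * X i ω) = ρ₀ (fun i => ρ i (X i)) := by
  have hinner : ∀ i, ∑ ω, p ω * ξ i ω * X i ω = ρ i (X i) := fun i =>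
    (eq_weighted_sum_of_posHomogeneous_of_subgradient (ρ i) (hρph i) (fun ω => p ω * ξ i ω)
      (X i) (hξ i)).symm
  simp_rw [hinner]
  exact (eq_weighted_sum_of_posHomogeneous_of_subgradient ρ₀ hρ₀ph (fun i => c i * ν i)
    (fun i => ρ i (X i)) hν).symm
end

section
/- Suppose each ρ_i (i : Fin m) is convex and positively homogeneous on the space of functions Ω → ℝ, and ρ_0 : (Fin m → ℝ) → ℝ is convex, positively homogeneous, and monotone. Then for every random vector X : Fin m → Ω → ℝ, ρ_sys(X) equals the maximum, over all ν : Fin m → ℝ that are subgradients of ρ_0 at 0 with respect to ⟨·,·⟩_c and all families ξ with ξ_i : Ω → ℝ a subgradient of ρ_i at 0 with respect to ⟨·,·⟩_p for each i, of the quantity ∑_i c i · ν i · (∑_ω p ω · ξ_i ω · X i ω); that is, every such choice gives a value ≤ ρ_sys(X) and some choice attains ρ_sys(X). -/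
/-- A convex positively homogeneous functional is subadditive. -/
theorem add_le_of_convex_of_posHom {E : Type*} [AddCommGroup E] [Module ℝ E] {N : E → ℝ}
    (hconv : ∀ x y : E, ∀ α : ℝ, α ∈ Set.Icc (0:ℝ) 1 →
      N (α • x + (1 - α) • y) ≤ α * N x + (1 - α) * N y)
    (hph : ∀ x : E, ∀ t : ℝ, 0 < t → N (t • x) = t * N x) (x y : E) :
    N (x + y) ≤ N x + N y := by
  have h := hconv x y (1 / 2) ⟨by norm_num, by norm_num⟩
  have hxy : (1 / 2 : ℝ) • x + (1 - 1 / 2 : ℝ) • y = (1 / 2 : ℝ) • (x + y) := by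
    rw [smul_add]; norm_num
  rw [hxy, hph _ _ (by norm_num)] at h
  linarith

/-- A positively homogeneous functional vanishes at the origin. -/
theorem map_zero_of_posHom {E : Type*} [AddCommGroup E] [Module ℝ E] {N : E → ℝ}
    (hph : ∀ x : E, ∀ t : ℝ, 0 < t → N (t • x) = t * N x) : N 0 = 0 := by
  have h := hph 0 2 two_pos
  rw [smul_zero] at h
  linarith

/-- A sublinear functional is supported at every point by a linear functional below it. -/
theorem exists_linearMap_le_sublinear_eq {E : Type*} [AddCommGroup E] [Module ℝ E] {N : E → ℝ}
    (hadd : ∀ x y : E, N (x + y) ≤ N x + N y)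
    (hph : ∀ x : E, ∀ t : ℝ, 0 < t → N (t • x) = t * N x) (x : E) :
    ∃ g : E →ₗ[ℝ] ℝ, g x = N x ∧ ∀ y, g y ≤ N y := by
  have h0 : N 0 = 0 := map_zero_of_posHom hph
  have hx : ∀ a : ℝ, a • x = 0 → a • N x = 0 := by
    intro a ha
    rcases smul_eq_zero.mp ha with h | h <;> simp [h, h0]
  obtain ⟨g, hg, hgN⟩ := exists_extension_of_le_sublinear
    (LinearPMap.mkSpanSingleton' x (N x) hx) N (fun t ht y => hph y t ht) hadd (by
      rintro ⟨y, hy⟩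
      obtain ⟨a, rfl⟩ := Submodule.mem_span_singleton.mp hy
      rw [LinearPMap.mkSpanSingleton'_apply, smul_eq_mul]
      rcases lt_trichotomy a 0 with ha | rfl | ha
      · have h := hadd (a • x) ((-a) • x)
        rw [hph x (-a) (by linarith), neg_smul, add_neg_cancel, h0] at h
        change a * N x ≤ N (a • x)
        linarith
      · simp [h0]
      · exact (hph x a ha).ge)
  refine ⟨g, ?_, hgN⟩
  rw [hg ⟨x, Submodule.mem_span_singleton_self x⟩]
  exact LinearPMap.mkSpanSingleton'_apply_self _ _ _ _

/-- In finite dimension, the supporting functional is represented by a vector with respect to a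
weighted pairing. -/
theorem exists_weighted_subgradient_eq {ι : Type*} [Fintype ι] {w : ι → ℝ} (hw : ∀ i, 0 < w i)
    {N : (ι → ℝ) → ℝ}
    (hconv : ∀ x y : ι → ℝ, ∀ α : ℝ, α ∈ Set.Icc (0:ℝ) 1 →
      N (α • x + (1 - α) • y) ≤ α * N x + (1 - α) * N y)
    (hph : ∀ x : ι → ℝ, ∀ t : ℝ, 0 < t → N (t • x) = t * N x) (x : ι → ℝ) :
    ∃ g : ι → ℝ, ∑ i, w i * g i * x i = N x ∧ ∀ y, ∑ i, w i * g i * y i ≤ N y := by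
  classical
  obtain ⟨g, hgx, hgN⟩ :=
    exists_linearMap_le_sublinear_eq (add_le_of_convex_of_posHom hconv hph) hph x
  have key : ∀ y, ∑ i, w i * (g (Pi.single i 1) / w i) * y i = g y := by
    intro y
    rw [LinearMap.pi_apply_eq_sum_univ g y]
    refine Finset.sum_congr rfl fun i _ => ?_
    have hs : (fun j => if i = j then (1 : ℝ) else 0) = Pi.single i 1 := by
      ext j; simp [Pi.single_apply, eq_comm]
    rw [mul_div_cancel₀ _ (hw i).ne', smul_eq_mul, hs, mul_comm]
  exact ⟨fun i => g (Pi.single i 1) / w i, (key x).trans hgx, fun y => (key y).trans_le (hgN y)⟩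

/-- Subgradients at the origin of a monotone functional are nonnegative. -/
theorem nonneg_of_weighted_subgradient {ι : Type*} [Fintype ι] {w : ι → ℝ} (hw : ∀ i, 0 < w i)
    {N : (ι → ℝ) → ℝ} (hmono : ∀ u v : ι → ℝ, (∀ i, u i ≤ v i) → N u ≤ N v) {g : ι → ℝ}
    (hg : ∀ v, N 0 + ∑ i, w i * g i * v i ≤ N v) (i : ι) : 0 ≤ g i := by
  classical
  have h1 := hg (Pi.single i (-1))
  have h2 : N (Pi.single i (-1)) ≤ N 0 := hmono _ _ fun j => by
    by_cases h : j = i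
    · subst h; simp
    · simp [h]
  have h3 : ∑ j, w j * g j * (Pi.single i (-1) : ι → ℝ) j = -(w i * g i) := by
    simp [Pi.single_apply]
  rw [h3] at h1
  exact nonneg_of_mul_nonneg_right (by linarith) (hw i)


/-- Dual (max) representation of the systemic risk measure: if each `ρ i`
is convex and positively homogeneous and `ρ₀` is convex, positively homogeneous, and
monotone, then for every `X`, `ρ_sys X = ρ₀ (fun i => ρ i (X i))` equals the maximum of
`∑ i, c i * ν i * (∑ ω, p ω * ξ i ω * X i ω)` over subgradients `ν` of `ρ₀` at `0`
(w.r.t. `⟨·,·⟩_c`) and families `ξ` with `ξ i` a subgradient of `ρ i` at `0`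
(w.r.t. `⟨·,·⟩_p`). -/
theorem systemic_risk_dual_representation {Ω : Type*} [Fintype Ω] [Nonempty Ω] {m : ℕ}
    (hm : 1 ≤ m)
    (p : Ω → ℝ) (hp : ∀ ω, 0 < p ω) (hp1 : ∑ ω, p ω = 1)
    (c : Fin m → ℝ) (hc : ∀ i, 0 < c i) (hc1 : ∑ i, c i = 1)
    (ρ : Fin m → (Ω → ℝ) → ℝ) (ρ₀ : (Fin m → ℝ) → ℝ)
    (hρconv : ∀ i : Fin m, ∀ x y : Ω → ℝ, ∀ α : ℝ, α ∈ Set.Icc (0:ℝ) 1 →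
      ρ i (α • x + (1 - α) • y) ≤ α * ρ i x + (1 - α) * ρ i y)
    (hρph : ∀ i : Fin m, ∀ Z : Ω → ℝ, ∀ t : ℝ, 0 < t → ρ i (t • Z) = t * ρ i Z)
    (hρ₀conv : ∀ x y : Fin m → ℝ, ∀ α : ℝ, α ∈ Set.Icc (0:ℝ) 1 →
      ρ₀ (α • x + (1 - α) • y) ≤ α * ρ₀ x + (1 - α) * ρ₀ y)
    (hρ₀ph : ∀ v : Fin m → ℝ, ∀ t : ℝ, 0 < t → ρ₀ (t • v) = t * ρ₀ v)
    (hρ₀mono : ∀ u v : Fin m → ℝ, (∀ i, u i ≤ v i) → ρ₀ u ≤ ρ₀ v) :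
    ∀ X : Fin m → Ω → ℝ,
      (∀ (ν : Fin m → ℝ) (ξ : Fin m → Ω → ℝ),
        (∀ v : Fin m → ℝ, ρ₀ v ≥ ρ₀ 0 + ∑ i, c i * ν i * (v i - 0)) →
        (∀ i : Fin m, ∀ Z : Ω → ℝ, ρ i Z ≥ ρ i 0 + ∑ ω, p ω * ξ i ω * (Z ω - 0)) →
          ∑ i, c i * ν i * (∑ ω, p ω * ξ i ω * X i ω) ≤ ρ₀ (fun i => ρ i (X i))) ∧
      (∃ (ν : Fin m → ℝ) (ξ : Fin m → Ω → ℝ),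
        (∀ v : Fin m → ℝ, ρ₀ v ≥ ρ₀ 0 + ∑ i, c i * ν i * (v i - 0)) ∧
        (∀ i : Fin m, ∀ Z : Ω → ℝ, ρ i Z ≥ ρ i 0 + ∑ ω, p ω * ξ i ω * (Z ω - 0)) ∧
          ∑ i, c i * ν i * (∑ ω, p ω * ξ i ω * X i ω) = ρ₀ (fun i => ρ i (X i))) := by
  have h0 : ρ₀ 0 = 0 := map_zero_of_posHom hρ₀ph
  have hi0 : ∀ i, ρ i 0 = 0 := fun i => map_zero_of_posHom (hρph i)
  simp only [h0, hi0, zero_add, sub_zero]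
  refine fun X => ⟨fun ν ξ hν hξ => ?_, ?_⟩
  · have hν0 : ∀ i, 0 ≤ ν i := nonneg_of_weighted_subgradient hc hρ₀mono fun v => by
      rw [h0, zero_add]; exact hν v
    refine le_trans (Finset.sum_le_sum fun i _ => ?_) (hν fun i => ρ i (X i))
    exact mul_le_mul_of_nonneg_left (hξ i (X i)) (mul_nonneg (hc i).le (hν0 i))
  · choose ξ hξX hξ using fun i => exists_weighted_subgradient_eq hp (hρconv i) (hρph i) (X i)
    obtain ⟨ν, hνX, hν⟩ :=
      exists_weighted_subgradient_eq hc hρ₀conv hρ₀ph fun i => ρ i (X i)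
    refine ⟨ν, ξ, hν, hξ, ?_⟩
    simp only [hξX]
    exact hνX
end

section
/- Let (Ω, 𝒜, μ) be a probability space, and let ρ_i : (Ω → ℝ) → ℝ for i : Fin m and ρ_0 : (Fin m → ℝ) → ℝ, with ρ_sys(X) = ρ_0 (fun i => ρ_i (fun ω => X ω i)). Suppose ρ_0 is monotone and each ρ_i is consistent with the increasing convex order: for all measurable integrable V, W : Ω → ℝ, if ∫ max(V − η, 0) dμ ≤ ∫ max(W − η, 0) dμ for all η ∈ ℝ, then ρ_i(V) ≤ ρ_i(W). If X, Y : Ω → (Fin m → ℝ) are measurable with all components integrable and X is linearly stochastically smaller than Y in the increasing convex order (for every c : Fin m → ℝ with c i ≥ 0 and ∑ i, c i = 1 and every η ∈ ℝ, ∫ max(∑_i c i · X ω i − η, 0) dμ ≤ ∫ max(∑_i c i · Y ω i − η, 0) dμ), then ρ_sys(X) ≤ ρ_sys(Y). -/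
open MeasureTheory

/-- If `ρ₀` is monotone and each `ρ i` is consistent with the increasing
convex order, then the systemic risk measure `ρ_sys X = ρ₀ (fun i => ρ i (X · i))` is
consistent with the linear increasing convex order on random vectors. -/
theorem systemic_risk_consistent_linear_icx {Ω : Type*} [MeasurableSpace Ω]
    (μ : Measure Ω) [IsProbabilityMeasure μ] {m : ℕ} (hm : 1 ≤ m)
    (ρ : Fin m → (Ω → ℝ) → ℝ) (ρ₀ : (Fin m → ℝ) → ℝ)
    (hρ₀mono : ∀ u v : Fin m → ℝ, (∀ i, u i ≤ v i) → ρ₀ u ≤ ρ₀ v)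
    (hρicx : ∀ i : Fin m, ∀ V W : Ω → ℝ, Measurable V → Measurable W →
      Integrable V μ → Integrable W μ →
      (∀ η : ℝ, ∫ ω, max (V ω - η) 0 ∂μ ≤ ∫ ω, max (W ω - η) 0 ∂μ) → ρ i V ≤ ρ i W)
    (X Y : Ω → Fin m → ℝ) (hXmeas : Measurable X) (hYmeas : Measurable Y)
    (hXint : ∀ i : Fin m, Integrable (fun ω => X ω i) μ)
    (hYint : ∀ i : Fin m, Integrable (fun ω => Y ω i) μ)
    (hord : ∀ c : Fin m → ℝ, (∀ i, 0 ≤ c i) → (∑ i, c i) = 1 → ∀ η : ℝ,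
      ∫ ω, max (∑ i, c i * X ω i - η) 0 ∂μ ≤ ∫ ω, max (∑ i, c i * Y ω i - η) 0 ∂μ) :
    ρ₀ (fun i => ρ i (fun ω => X ω i)) ≤ ρ₀ (fun i => ρ i (fun ω => Y ω i)) := by
  refine hρ₀mono _ _ fun i => hρicx i _ _ ((measurable_pi_apply i).comp hXmeas)
    ((measurable_pi_apply i).comp hYmeas) (hXint i) (hYint i) fun η => ?_
  have hc : ∀ j, 0 ≤ (Pi.single i 1 : Fin m → ℝ) j := fun j =>
    (Pi.single_nonneg.mpr zero_le_one : (0 : Fin m → ℝ) ≤ Pi.single i 1) j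
  simpa [Pi.single_apply] using hord (Pi.single i 1) hc (by simp) η
end

section
/- Let S be a nonempty subset of the simplex {c : Fin m → ℝ | c i ≥ 0 for all i, ∑ i, c i = 1}, and let ρ : (Ω → ℝ) → ℝ be convex, monotone, positively homogeneous, and satisfy the translation property ρ(Z + a•𝟙) = ρ(Z) + a for every Z : Ω → ℝ and a ∈ ℝ. Define ρ_S : (Fin m → Ω → ℝ) → ℝ by ρ_S(X) = ρ(fun ω => sSup {∑_i c i · X i ω | c ∈ S}). Then ρ_S satisfies the axioms of a systemic coherent risk measure: (A1) ρ_S is convex; (A2) ρ_S is monotone, i.e. X i ω ≤ Y i ω for all i, ω implies ρ_S(X) ≤ ρ_S(Y); (A3) ρ_S(X + a•𝟙) = ρ_S(X) + a · ρ_S(𝟙) for all a ∈ ℝ, where 𝟙 is the constant-one random vector; and (A4) ρ_S(t • X) = t · ρ_S(X) for all t > 0. -/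
section SimplexSupport

variable {m : ℕ} {S : Set (Fin m → ℝ)}

theorem bddAbove_weightedSum_image
    (hS : S ⊆ {c : Fin m → ℝ | (∀ i, 0 ≤ c i) ∧ ∑ i, c i = 1}) (x : Fin m → ℝ) :
    BddAbove ((fun c : Fin m → ℝ => ∑ i, c i * x i) '' S) := by
  refine ⟨∑ i, |x i|, ?_⟩
  rintro _ ⟨c, hc, rfl⟩
  obtain ⟨h0, h1⟩ := hS hc
  refine Finset.sum_le_sum fun i _ => ?_
  have hci : c i ≤ 1 := h1 ▸ Finset.single_le_sum (fun j _ => h0 j) (Finset.mem_univ i)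
  calc c i * x i ≤ c i * |x i| := mul_le_mul_of_nonneg_left (le_abs_self _) (h0 i)
    _ ≤ |x i| := mul_le_of_le_one_left (abs_nonneg _) hci

theorem sSup_weightedSum_mono (hne : S.Nonempty)
    (hS : S ⊆ {c : Fin m → ℝ | (∀ i, 0 ≤ c i) ∧ ∑ i, c i = 1}) {x y : Fin m → ℝ}
    (hxy : ∀ i, x i ≤ y i) :
    sSup ((fun c : Fin m → ℝ => ∑ i, c i * x i) '' S) ≤
      sSup ((fun c : Fin m → ℝ => ∑ i, c i * y i) '' S) := by
  refine csSup_le (hne.image _) ?_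
  rintro _ ⟨c, hc, rfl⟩
  exact (Finset.sum_le_sum fun i _ => mul_le_mul_of_nonneg_left (hxy i) ((hS hc).1 i)).trans
    (le_csSup (bddAbove_weightedSum_image hS y) ⟨c, hc, rfl⟩)

theorem sSup_weightedSum_add_le (hne : S.Nonempty)
    (hS : S ⊆ {c : Fin m → ℝ | (∀ i, 0 ≤ c i) ∧ ∑ i, c i = 1}) (x y : Fin m → ℝ) :
    sSup ((fun c : Fin m → ℝ => ∑ i, c i * (x i + y i)) '' S) ≤
      sSup ((fun c : Fin m → ℝ => ∑ i, c i * x i) '' S) +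
        sSup ((fun c : Fin m → ℝ => ∑ i, c i * y i) '' S) := by
  refine csSup_le (hne.image _) ?_
  rintro _ ⟨c, hc, rfl⟩
  simp only [mul_add, Finset.sum_add_distrib]
  exact add_le_add (le_csSup (bddAbove_weightedSum_image hS x) ⟨c, hc, rfl⟩)
    (le_csSup (bddAbove_weightedSum_image hS y) ⟨c, hc, rfl⟩)

theorem sSup_weightedSum_const_mul {t : ℝ} (ht : 0 ≤ t) (x : Fin m → ℝ) :
    sSup ((fun c : Fin m → ℝ => ∑ i, c i * (t * x i)) '' S) =
      t * sSup ((fun c : Fin m → ℝ => ∑ i, c i * x i) '' S) := by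
  rw [← smul_eq_mul, ← Real.sSup_smul_of_nonneg ht, ← Set.image_smul, Set.image_image]
  simp only [smul_eq_mul, Finset.mul_sum, mul_left_comm]

theorem sSup_weightedSum_const (hne : S.Nonempty)
    (hS : S ⊆ {c : Fin m → ℝ | (∀ i, 0 ≤ c i) ∧ ∑ i, c i = 1}) (a : ℝ) :
    sSup ((fun c : Fin m → ℝ => ∑ i, c i * a) '' S) = a := by
  have h : (fun c : Fin m → ℝ => ∑ i, c i * a) '' S = (fun _ => a) '' S :=
    Set.image_congr fun c hc => by rw [← Finset.sum_mul, (hS hc).2, one_mul]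
  rw [h, hne.image_const, csSup_singleton]

theorem sSup_weightedSum_add_const (hne : S.Nonempty)
    (hS : S ⊆ {c : Fin m → ℝ | (∀ i, 0 ≤ c i) ∧ ∑ i, c i = 1}) (x : Fin m → ℝ) (a : ℝ) :
    sSup ((fun c : Fin m → ℝ => ∑ i, c i * (x i + a)) '' S) =
      sSup ((fun c : Fin m → ℝ => ∑ i, c i * x i) '' S) + a := by
  have h₁ := sSup_weightedSum_add_le hne hS x fun _ => a
  have h₂ := sSup_weightedSum_add_le hne hS (fun i => x i + a) fun _ => -a
  simp only [add_neg_cancel_right, sSup_weightedSum_const hne hS] at h₁ h₂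
  linarith

end SimplexSupport

/-- If `ρ` is a (univariate) coherent risk measure — convex, monotone,
positively homogeneous, with the translation property — and `S` is a nonempty subset of
the simplex, then `ρ_S X = ρ (fun ω => sSup {∑ i, c i * X i ω | c ∈ S})` satisfies the
axioms (A1)–(A4) of a systemic coherent risk measure. -/
theorem rho_S_systemic_coherent {Ω : Type*} [Fintype Ω] [Nonempty Ω] {m : ℕ} (hm : 1 ≤ m)
    (S : Set (Fin m → ℝ)) (hS_ne : S.Nonempty)
    (hS : S ⊆ {c : Fin m → ℝ | (∀ i, 0 ≤ c i) ∧ ∑ i, c i = 1})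
    (ρ : (Ω → ℝ) → ℝ)
    (hρconv : ∀ x y : Ω → ℝ, ∀ α : ℝ, α ∈ Set.Icc (0:ℝ) 1 →
      ρ (α • x + (1 - α) • y) ≤ α * ρ x + (1 - α) * ρ y)
    (hρmono : ∀ u v : Ω → ℝ, (∀ ω, u ω ≤ v ω) → ρ u ≤ ρ v)
    (hρph : ∀ Z : Ω → ℝ, ∀ t : ℝ, 0 < t → ρ (t • Z) = t * ρ Z)
    (hρtr : ∀ Z : Ω → ℝ, ∀ a : ℝ, ρ (Z + a • (1 : Ω → ℝ)) = ρ Z + a) :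
    -- `ρ_S X = ρ (fun ω => sSup ((fun c => ∑ i, c i * X i ω) '' S))`
    (∀ X Y : Fin m → Ω → ℝ, ∀ α : ℝ, α ∈ Set.Icc (0:ℝ) 1 →
      ρ (fun ω => sSup ((fun c : Fin m → ℝ =>
          ∑ i, c i * (α • X + (1 - α) • Y) i ω) '' S)) ≤
        α * ρ (fun ω => sSup ((fun c : Fin m → ℝ => ∑ i, c i * X i ω) '' S)) +
          (1 - α) * ρ (fun ω => sSup ((fun c : Fin m → ℝ => ∑ i, c i * Y i ω) '' S))) ∧
    (∀ X Y : Fin m → Ω → ℝ, (∀ i ω, X i ω ≤ Y i ω) →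
      ρ (fun ω => sSup ((fun c : Fin m → ℝ => ∑ i, c i * X i ω) '' S)) ≤
        ρ (fun ω => sSup ((fun c : Fin m → ℝ => ∑ i, c i * Y i ω) '' S))) ∧
    (∀ X : Fin m → Ω → ℝ, ∀ a : ℝ,
      ρ (fun ω => sSup ((fun c : Fin m → ℝ =>
          ∑ i, c i * (X + a • (1 : Fin m → Ω → ℝ)) i ω) '' S)) =
        ρ (fun ω => sSup ((fun c : Fin m → ℝ => ∑ i, c i * X i ω) '' S)) +
          a * ρ (fun ω => sSup ((fun c : Fin m → ℝ =>
            ∑ i, c i * (1 : Fin m → Ω → ℝ) i ω) '' S))) ∧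
    (∀ X : Fin m → Ω → ℝ, ∀ t : ℝ, 0 < t →
      ρ (fun ω => sSup ((fun c : Fin m → ℝ => ∑ i, c i * (t • X) i ω) '' S)) =
        t * ρ (fun ω => sSup ((fun c : Fin m → ℝ => ∑ i, c i * X i ω) '' S))) := by
  refine ⟨fun X Y α hα => ?_, fun X Y hXY => ?_, fun X a => ?_, fun X t ht => ?_⟩
  · refine (hρmono _ _ fun ω => ?_).trans (hρconv _ _ α hα)
    simp only [Pi.add_apply, Pi.smul_apply, smul_eq_mul]
    rw [← sSup_weightedSum_const_mul hα.1, ← sSup_weightedSum_const_mul (sub_nonneg.2 hα.2)]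
    exact sSup_weightedSum_add_le hS_ne hS _ _
  · exact hρmono _ _ fun ω => sSup_weightedSum_mono hS_ne hS fun i => hXY i ω
  · have hzero : ρ 0 = 0 := by
      have h := hρph 0 2 two_pos
      rw [smul_zero] at h
      linarith
    have hone : ρ (fun _ => 1) = 1 := by
      have h := hρtr 0 1
      rwa [zero_add, one_smul, hzero, zero_add] at h
    simp only [Pi.add_apply, Pi.smul_apply, Pi.one_apply, smul_eq_mul,
      sSup_weightedSum_const hS_ne hS, hone]
    rw [mul_one, ← hρtr]
    congr 1
    funext ω
    simpa using sSup_weightedSum_add_const hS_ne hS (fun i => X i ω) a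
  · rw [← hρph _ t ht]
    congr 1
    funext ω
    exact sSup_weightedSum_const_mul ht.le fun i => X i ω
end
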